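/- arXiv:1911.08214 — 3 statements merged into one kernel-verified Lean document; each statement's English description precedes it below -/
import Mathlib

section
/- Suppose in addition that 𝔫 ≠ {0} and the only ad(𝔥)-invariant subspaces of 𝔫 are {0} and 𝔫. Then 𝓜_T(𝔨) consists of the single inner product (tr_Q T)·Q|_𝔫, where tr_Q T = Σ_a T(e_a,e_a) for a Q-orthonormal basis {e_a} of 𝔫, and consequently σ(𝔨,T) = −( 2·tr_Q B|_𝔫 + ⟨𝔫𝔫𝔫⟩ + 2·⟨𝔫𝔩𝔩⟩ ) / ( 4·tr_Q T ), where tr_Q B|_𝔫 = Σ_a B(e_a,e_a). -/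
open scoped BigOperators

/-- `⟨𝔲₁𝔲₂𝔲₃⟩ = Σ_{a,b,c} Q([f_b, g_c], e_a)²`, computed from `Q`-orthonormal bases
`e`, `f`, `g` of the subspaces 𝔲₁, 𝔲₂, 𝔲₃. -/
def bracketNormSq {𝔤 : Type*} [LieRing 𝔤] [LieAlgebra ℝ 𝔤]
    (Q : 𝔤 →ₗ[ℝ] 𝔤 →ₗ[ℝ] ℝ) {n₁ n₂ n₃ : ℕ}
    (e : Fin n₁ → 𝔤) (f : Fin n₂ → 𝔤) (g : Fin n₃ → 𝔤) : ℝ :=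
  ∑ a, ∑ b, ∑ c, (Q ⁅f b, g c⁆ (e a)) ^ 2


theorem aux_expand {G : Type*} [AddCommGroup G] [Module ℝ G]
    (Q : G →ₗ[ℝ] G →ₗ[ℝ] ℝ) {N : ℕ} (w : Fin N → G) (c : ℝ)
    (hw : ∀ a b, c * Q (w a) (w b) = if a = b then 1 else 0)
    (v : G) (hv : v ∈ Submodule.span ℝ (Set.range w)) :
    v = ∑ a, (c * Q v (w a)) • w a := by
  induction hv using Submodule.span_induction with
  | mem x hx =>
    obtain ⟨b, rfl⟩ := hx
    simp [hw]
  | zero => simp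
  | add x y _ _ hx hy =>
    conv_lhs => rw [hx, hy]
    simp [mul_add, add_smul, Finset.sum_add_distrib]
  | smul r x _ hx =>
    conv_lhs => rw [hx]
    rw [Finset.smul_sum]
    refine Finset.sum_congr rfl fun a _ => ?_
    rw [smul_smul]
    congr 1
    simp
    ring

theorem aux_trace {G : Type*} [AddCommGroup G] [Module ℝ G]
    (Q : G →ₗ[ℝ] G →ₗ[ℝ] ℝ) (hQs : ∀ v w, Q v w = Q w v) (U : Submodule ℝ G)
    {n N : ℕ} (e : Fin n → G) (w : Fin N → G) (c : ℝ)
    (he : ∀ a b, Q (e a) (e b) = if a = b then 1 else 0)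
    (hes : Submodule.span ℝ (Set.range e) = U)
    (hw : ∀ a b, c * Q (w a) (w b) = if a = b then 1 else 0)
    (hws : Submodule.span ℝ (Set.range w) = U)
    (F : G →ₗ[ℝ] G →ₗ[ℝ] ℝ) :
    ∑ b, F (e b) (e b) = c * ∑ a, F (w a) (w a) := by
  have he' : ∀ b, e b ∈ U := fun b => hes ▸ Submodule.subset_span ⟨b, rfl⟩
  have hw' : ∀ b, w b ∈ U := fun b => hws ▸ Submodule.subset_span ⟨b, rfl⟩
  have h1 : ∀ b, F (e b) (e b) = ∑ a, c * Q (e b) (w a) * F (w a) (e b) := by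
    intro b
    have := aux_expand Q w c hw (e b) (hws ▸ he' b)
    have h2 := congrArg (fun x => F x (e b)) this
    simpa using h2
  have h3 : ∀ a, F (w a) (w a) = ∑ b, Q (w a) (e b) * F (w a) (e b) := by
    intro a
    have := aux_expand Q e 1 (by simpa using he) (w a) (hes ▸ hw' a)
    have h2 := congrArg (fun x => F (w a) x) this
    simpa using h2
  simp_rw [h1, h3]
  rw [Finset.sum_comm, Finset.mul_sum]
  refine Finset.sum_congr rfl fun a _ => ?_
  rw [Finset.mul_sum]
  refine Finset.sum_congr rfl fun b _ => ?_
  rw [hQs (e b) (w a)]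
  ring

theorem aux_parseval {G : Type*} [AddCommGroup G] [Module ℝ G]
    (Q : G →ₗ[ℝ] G →ₗ[ℝ] ℝ) (U : Submodule ℝ G)
    {n : ℕ} (e : Fin n → G)
    (he : ∀ a b, Q (e a) (e b) = if a = b then 1 else 0)
    (hes : Submodule.span ℝ (Set.range e) = U)
    (p : G →ₗ[ℝ] G) (hp : ∀ v, p v ∈ U) (ho : ∀ v, ∀ w ∈ U, Q (v - p v) w = 0) (x : G) :
    Q (p x) (p x) = ∑ c, (Q x (e c)) ^ 2 := by
  have := aux_expand Q e 1 (by simpa using he) (p x) (hes ▸ hp x)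
  have h2 := congrArg (fun y => Q (p x) y) this
  have h3 : ∀ c, Q (p x) (e c) = Q x (e c) := by
    intro c
    have := ho x (e c) (hes ▸ Submodule.subset_span ⟨c, rfl⟩)
    simp at this
    linarith
  simp only [map_sum, map_smul, smul_eq_mul, one_mul, h3] at h2
  rw [h2]
  exact Finset.sum_congr rfl fun c _ => by ring

theorem aux_eig {G : Type*} [AddCommGroup G] [Module ℝ G]
    (Q : G →ₗ[ℝ] G →ₗ[ℝ] ℝ) (U : Submodule ℝ G) (hU : U ≠ ⊥)
    {n : ℕ} (e : Fin n → G)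
    (he : ∀ a b, Q (e a) (e b) = if a = b then 1 else 0)
    (hes : Submodule.span ℝ (Set.range e) = U)
    (h : G →ₗ[ℝ] G →ₗ[ℝ] ℝ) (hs : ∀ v w, h v w = h w v) :
    ∃ (l : ℝ) (v : G), v ∈ U ∧ v ≠ 0 ∧ ∀ u ∈ U, h v u = l * Q v u := by
  have hn : Nonempty (Fin n) := by
    by_contra hc
    rw [not_nonempty_iff] at hc
    apply hU
    rw [← hes, Set.range_eq_empty, Submodule.span_empty]
  obtain ⟨i⟩ := hn
  let M : Matrix (Fin n) (Fin n) ℝ := Matrix.of fun a b => h (e a) (e b)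
  have hM : M.IsHermitian := by
    ext a b
    simp [M, hs (e b) (e a)]
  let x : Fin n → ℝ := ⇑(hM.eigenvectorBasis i)
  have hx : M.mulVec x = hM.eigenvalues i • x := hM.mulVec_eigenvectorBasis i
  have hx0 : ∃ j, x j ≠ 0 := by
    by_contra hc
    push Not at hc
    apply hM.eigenvectorBasis.orthonormal.ne_zero i
    ext j
    exact hc j
  have hQ : ∀ b, Q (∑ a, x a • e a) (e b) = x b := by
    intro b
    simp [he]
  refine ⟨hM.eigenvalues i, ∑ a, x a • e a, ?_, ?_, ?_⟩
  · exact Submodule.sum_mem _ fun a _ => Submodule.smul_mem _ _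
      (hes ▸ Submodule.subset_span ⟨a, rfl⟩)
  · intro h0
    obtain ⟨j, hj⟩ := hx0
    apply hj
    rw [← hQ j, h0]
    simp
  · intro u hu
    rw [← hes] at hu
    induction hu using Submodule.span_induction with
    | mem y hy =>
      obtain ⟨b, rfl⟩ := hy
      rw [hQ]
      have := congrFun hx b
      simp only [Matrix.mulVec, dotProduct, M, Matrix.of_apply, Pi.smul_apply, smul_eq_mul] at this
      rw [← this]
      simp only [map_sum, map_smul, LinearMap.sum_apply, LinearMap.smul_apply, smul_eq_mul]
      exact Finset.sum_congr rfl fun a _ => by rw [hs (e a) (e b)]; ring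
    | zero => simp
    | add y z _ _ hy hz => rw [map_add, map_add, hy, hz]; ring
    | smul r y _ hy => rw [map_smul, map_smul, hy, smul_eq_mul, smul_eq_mul]; ring

/-- If `ad(𝔥)` acts irreducibly on `𝔫 ≠ 0`, then `𝓜_T(𝔨)` consists of the single inner
product `(tr_Q T)·Q|_𝔫`, and consequently
`σ(𝔨,T) = −(2 tr_Q B|𝔫 + ⟨𝔫𝔫𝔫⟩ + 2⟨𝔫𝔩𝔩⟩)/(4 tr_Q T)`. -/
theorem stmt5 {𝔤 : Type*} [LieRing 𝔤] [LieAlgebra ℝ 𝔤] [FiniteDimensional ℝ 𝔤]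
    (Q : 𝔤 →ₗ[ℝ] 𝔤 →ₗ[ℝ] ℝ)
    (hQsymm : ∀ v w, Q v w = Q w v)
    (hQpos : ∀ v, v ≠ 0 → 0 < Q v v)
    (hQad : ∀ z v w : 𝔤, Q ⁅z, v⁆ w + Q v ⁅z, w⁆ = 0)
    -- Lie subalgebras 𝔥 ⊆ 𝔨 with 𝔥 ≠ 𝔨
    (𝔥 𝔨 : LieSubalgebra ℝ 𝔤) (h𝔥𝔨 : 𝔥 ≤ 𝔨) (h𝔥ne : 𝔥 ≠ 𝔨)
    -- 𝔫 = Q-orthogonal complement of 𝔥 in 𝔨, 𝔩 = Q-orthogonal complement of 𝔨 in 𝔤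
    (𝔫 𝔩 : Submodule ℝ 𝔤)
    (h𝔫 : ∀ v, v ∈ 𝔫 ↔ v ∈ 𝔨 ∧ ∀ z ∈ 𝔥, Q v z = 0)
    (h𝔩 : ∀ v, v ∈ 𝔩 ↔ ∀ z ∈ 𝔨, Q v z = 0)
    -- 𝔫 ≠ 0 and the only ad(𝔥)-invariant subspaces of 𝔫 are 0 and 𝔫
    (h𝔫nz : 𝔫 ≠ ⊥)
    (hirr : ∀ 𝔳 : Submodule ℝ 𝔤, 𝔳 ≤ 𝔫 → (∀ z ∈ 𝔥, ∀ v ∈ 𝔳, ⁅z, v⁆ ∈ 𝔳) →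
      𝔳 = ⊥ ∨ 𝔳 = 𝔫)
    -- T : a positive-definite symmetric bilinear form on 𝔫
    (T : 𝔤 →ₗ[ℝ] 𝔤 →ₗ[ℝ] ℝ)
    (hTsymm : ∀ v w, T v w = T w v)
    (hTpos : ∀ v ∈ 𝔫, v ≠ 0 → 0 < T v v)
    -- Q-orthogonal projections onto 𝔫 and 𝔩
    (πn : 𝔤 →ₗ[ℝ] 𝔤)
    (hπn_mem : ∀ v, πn v ∈ 𝔫) (hπn_id : ∀ v ∈ 𝔫, πn v = v)
    (hπn_orth : ∀ v, ∀ w ∈ 𝔫, Q (v - πn v) w = 0)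
    (πl : 𝔤 →ₗ[ℝ] 𝔤)
    (hπl_mem : ∀ v, πl v ∈ 𝔩) (hπl_id : ∀ v ∈ 𝔩, πl v = v)
    (hπl_orth : ∀ v, ∀ w ∈ 𝔩, Q (v - πl v) w = 0)
    -- a Q-orthonormal basis of 𝔫
    {n : ℕ} (e : Fin n → 𝔤)
    (he_mem : ∀ a, e a ∈ 𝔫)
    (he_span : Submodule.span ℝ (Set.range e) = 𝔫)
    (he_on : ∀ a b, Q (e a) (e b) = if a = b then 1 else 0)
    -- a Q-orthonormal basis of 𝔩
    {m : ℕ} (vb : Fin m → 𝔤)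
    (hvb_mem : ∀ a, vb a ∈ 𝔩)
    (hvb_span : Submodule.span ℝ (Set.range vb) = 𝔩)
    (hvb_on : ∀ a b, Q (vb a) (vb b) = if a = b then 1 else 0)
    -- S = { Ŝ(h) : h ∈ 𝓜_T(𝔨) }, each Ŝ(h) computed from an h-orthonormal basis of 𝔫
    (S : Set ℝ)
    (hS : ∀ r : ℝ, r ∈ S ↔
      ∃ (h : 𝔤 →ₗ[ℝ] 𝔤 →ₗ[ℝ] ℝ) (N : ℕ) (w : Fin N → 𝔤),
        (∀ v w', h v w' = h w' v) ∧
        (∀ v ∈ 𝔫, v ≠ 0 → 0 < h v v) ∧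
        (∀ z ∈ 𝔥, ∀ v ∈ 𝔫, ∀ w' ∈ 𝔫, h ⁅z, v⁆ w' + h v ⁅z, w'⁆ = 0) ∧
        (∀ a, w a ∈ 𝔫) ∧
        Submodule.span ℝ (Set.range w) = 𝔫 ∧
        (∀ a b, h (w a) (w b) = if a = b then 1 else 0) ∧
        (∑ a, T (w a) (w a)) = 1 ∧
        r = -(1/2) * (∑ a, killingForm ℝ 𝔤 (w a) (w a))
            - (1/2) * (∑ a, ∑ b', Q (πl ⁅w a, vb b'⁆) (πl ⁅w a, vb b'⁆))
            - (1/4) * (∑ a, ∑ a', h (πn ⁅w a, w a'⁆) (πn ⁅w a, w a'⁆))) :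
    -- (tr_Q T)·Q is an inner product on 𝔫 and belongs to 𝓜_T(𝔨) …
    (0 < ∑ a, T (e a) (e a)) ∧
    (∀ z ∈ 𝔥, ∀ v w : 𝔤,
      (∑ a, T (e a) (e a)) * Q ⁅z, v⁆ w + (∑ a, T (e a) (e a)) * Q v ⁅z, w⁆ = 0) ∧
    (∃ (N : ℕ) (w : Fin N → 𝔤),
      (∀ a, w a ∈ 𝔫) ∧
      Submodule.span ℝ (Set.range w) = 𝔫 ∧
      (∀ a b, (∑ a', T (e a') (e a')) * Q (w a) (w b) = if a = b then 1 else 0) ∧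
      (∑ a, T (w a) (w a)) = 1) ∧
    -- … and it is the only element of 𝓜_T(𝔨):
    (∀ (h : 𝔤 →ₗ[ℝ] 𝔤 →ₗ[ℝ] ℝ),
      (∀ v w', h v w' = h w' v) →
      (∀ v ∈ 𝔫, v ≠ 0 → 0 < h v v) →
      (∀ z ∈ 𝔥, ∀ v ∈ 𝔫, ∀ w' ∈ 𝔫, h ⁅z, v⁆ w' + h v ⁅z, w'⁆ = 0) →
      ∀ (N : ℕ) (w : Fin N → 𝔤),
        (∀ a, w a ∈ 𝔫) →
        Submodule.span ℝ (Set.range w) = 𝔫 →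
        (∀ a b, h (w a) (w b) = if a = b then 1 else 0) →
        (∑ a, T (w a) (w a)) = 1 →
        ∀ v ∈ 𝔫, ∀ u ∈ 𝔫, h v u = (∑ a, T (e a) (e a)) * Q v u) ∧
    -- consequently σ(𝔨,T) has the stated value:
    sSup S = -(2 * (∑ a, killingForm ℝ 𝔤 (e a) (e a))
        + bracketNormSq Q e e e + 2 * bracketNormSq Q e vb vb)
      / (4 * ∑ a, T (e a) (e a)) := by
  have hbr : ∀ z ∈ 𝔥, ∀ v ∈ 𝔫, ⁅z, v⁆ ∈ 𝔫 := by
    intro z hz v hv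
    rw [h𝔫] at hv ⊢
    refine ⟨𝔨.lie_mem (h𝔥𝔨 hz) hv.1, fun y hy => ?_⟩
    have h1 := hQad z v y
    have h2 := hv.2 _ (𝔥.lie_mem hz hy)
    linarith
  have hene : ∀ a, e a ≠ 0 := by
    intro a h0
    have := he_on a a
    rw [h0] at this
    simp at this
  have hn : Nonempty (Fin n) := by
    by_contra hc
    rw [not_nonempty_iff] at hc
    apply h𝔫nz
    rw [← he_span, Set.range_eq_empty, Submodule.span_empty]
  have ht : 0 < ∑ a, T (e a) (e a) :=
    Finset.sum_pos (fun a _ => hTpos _ (he_mem a) (hene a)) Finset.univ_nonempty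
  have huniq : ∀ (h : 𝔤 →ₗ[ℝ] 𝔤 →ₗ[ℝ] ℝ),
      (∀ v w', h v w' = h w' v) →
      (∀ z ∈ 𝔥, ∀ v ∈ 𝔫, ∀ w' ∈ 𝔫, h ⁅z, v⁆ w' + h v ⁅z, w'⁆ = 0) →
      ∀ (N : ℕ) (w : Fin N → 𝔤),
        (∀ a, w a ∈ 𝔫) →
        Submodule.span ℝ (Set.range w) = 𝔫 →
        (∀ a b, h (w a) (w b) = if a = b then 1 else 0) →
        (∑ a, T (w a) (w a)) = 1 →
        ∀ v ∈ 𝔫, ∀ u ∈ 𝔫, h v u = (∑ a, T (e a) (e a)) * Q v u := by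
    intro h hs had N w hwm hws hwo hwT
    obtain ⟨l, v0, hv0, hv0ne, hv0e⟩ := aux_eig Q 𝔫 h𝔫nz e he_on he_span h hs
    let V : Submodule ℝ 𝔤 :=
      { carrier := {v | v ∈ 𝔫 ∧ ∀ u ∈ 𝔫, h v u = l * Q v u}
        add_mem' := by
          rintro x y ⟨hx, hx'⟩ ⟨hy, hy'⟩
          refine ⟨𝔫.add_mem hx hy, fun u hu => ?_⟩
          simp [hx' u hu, hy' u hu, mul_add]
        zero_mem' := ⟨𝔫.zero_mem, by simp⟩
        smul_mem' := by
          rintro r x ⟨hx, hx'⟩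
          refine ⟨𝔫.smul_mem r hx, fun u hu => ?_⟩
          simp only [map_smul, LinearMap.smul_apply, smul_eq_mul, hx' u hu]
          ring }
    have hV : V = ⊥ ∨ V = 𝔫 := by
      refine hirr V (fun v hv => hv.1) ?_
      rintro z hz v ⟨hv, hv'⟩
      refine ⟨hbr z hz v hv, fun u hu => ?_⟩
      have h1 := had z hz v hv u hu
      have h2 := hQad z v u
      rw [hv' _ (hbr z hz u hu)] at h1
      have h3 : Q v ⁅z, u⁆ = - Q ⁅z, v⁆ u := by linarith
      rw [h3] at h1
      linarith
    have hV' : V = 𝔫 := by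
      refine hV.resolve_left fun hb => hv0ne ?_
      have : v0 ∈ V := ⟨hv0, hv0e⟩
      rw [hb] at this
      exact this
    have hl : ∀ v ∈ 𝔫, ∀ u ∈ 𝔫, h v u = l * Q v u := by
      intro v hv
      rw [← hV'] at hv
      exact hv.2
    have htr := aux_trace Q hQsymm 𝔫 e w l he_on he_span
      (fun a b => by rw [← hl _ (hwm a) _ (hwm b), hwo]) hws T
    rw [hwT, mul_one] at htr
    rw [htr]
    exact hl
  set t := ∑ a, T (e a) (e a) with ht_def
  let s : ℝ := (Real.sqrt t)⁻¹
  have hss : t * (s * s) = 1 := by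
    have h1 : Real.sqrt t * Real.sqrt t = t := Real.mul_self_sqrt ht.le
    have h2 : Real.sqrt t ≠ 0 := (Real.sqrt_pos.2 ht).ne'
    simp only [s]
    rw [← mul_inv, h1]
    exact mul_inv_cancel₀ ht.ne'
  have hs0 : s ≠ 0 := by
    intro h0
    rw [h0] at hss
    simp at hss
  let w0 : Fin n → 𝔤 := fun a => s • e a
  have hw0m : ∀ a, w0 a ∈ 𝔫 := fun a => 𝔫.smul_mem s (he_mem a)
  have hw0s : Submodule.span ℝ (Set.range w0) = 𝔫 := by
    apply le_antisymm
    · rw [Submodule.span_le]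
      rintro _ ⟨a, rfl⟩
      exact hw0m a
    · conv_lhs => rw [← he_span]
      rw [Submodule.span_le]
      rintro _ ⟨a, rfl⟩
      have : e a = s⁻¹ • w0 a := by
        simp only [w0]
        rw [smul_smul, inv_mul_cancel₀ hs0, one_smul]
      rw [this]
      exact Submodule.smul_mem _ _ (Submodule.subset_span ⟨a, rfl⟩)
  have hw0o : ∀ a b, t * Q (w0 a) (w0 b) = if a = b then 1 else 0 := by
    intro a b
    simp only [w0, map_smul, LinearMap.smul_apply, smul_eq_mul, he_on]
    split_ifs
    · linarith
    · simp
  have hw0T : (∑ a, T (w0 a) (w0 a)) = 1 := by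
    have := aux_trace Q hQsymm 𝔫 e w0 t he_on he_span hw0o hw0s T
    rw [← ht_def] at this
    have h2 : t * (∑ a, T (w0 a) (w0 a)) = t * 1 := by linarith
    exact mul_left_cancel₀ ht.ne' h2
  have hL : ∑ a, ∑ b', Q (πl ⁅e a, vb b'⁆) (πl ⁅e a, vb b'⁆) = bracketNormSq Q e vb vb := by
    unfold bracketNormSq
    refine Finset.sum_congr rfl fun a _ => Finset.sum_congr rfl fun b _ => ?_
    rw [aux_parseval Q 𝔩 vb hvb_on hvb_span πl hπl_mem hπl_orth]
    refine Finset.sum_congr rfl fun c _ => ?_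
    have h1 := hQad (vb b) (e a) (vb c)
    rw [← lie_skew, map_neg, LinearMap.neg_apply, hQsymm ⁅vb b, vb c⁆]
    have : -Q ⁅vb b, e a⁆ (vb c) = Q (e a) ⁅vb b, vb c⁆ := by linarith
    rw [this]
  have hN : ∑ a, ∑ b, Q (πn ⁅e a, e b⁆) (πn ⁅e a, e b⁆) = bracketNormSq Q e e e := by
    unfold bracketNormSq
    simp_rw [aux_parseval Q 𝔫 e he_on he_span πn hπn_mem hπn_orth]
    symm
    rw [Finset.sum_comm]
    exact Finset.sum_congr rfl fun a _ => Finset.sum_comm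
  have hval : ∀ (h : 𝔤 →ₗ[ℝ] 𝔤 →ₗ[ℝ] ℝ) (N : ℕ) (w : Fin N → 𝔤),
      (∀ v ∈ 𝔫, ∀ u ∈ 𝔫, h v u = t * Q v u) → (∀ a, w a ∈ 𝔫) →
      Submodule.span ℝ (Set.range w) = 𝔫 →
      (∀ a b, t * Q (w a) (w b) = if a = b then 1 else 0) →
      -(1/2) * (∑ a, killingForm ℝ 𝔤 (w a) (w a))
            - (1/2) * (∑ a, ∑ b', Q (πl ⁅w a, vb b'⁆) (πl ⁅w a, vb b'⁆))
            - (1/4) * (∑ a, ∑ a', h (πn ⁅w a, w a'⁆) (πn ⁅w a, w a'⁆)) =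
      -(2 * (∑ a, killingForm ℝ 𝔤 (e a) (e a))
        + bracketNormSq Q e e e + 2 * bracketNormSq Q e vb vb) / (4 * t) := by
    intro h N w hh hwm hws hwo
    have htr := aux_trace Q hQsymm 𝔫 e w t he_on he_span hwo hws
    have e1 := htr (killingForm ℝ 𝔤)
    have e2 : bracketNormSq Q e vb vb
        = t * ∑ a, ∑ b', Q (πl ⁅w a, vb b'⁆) (πl ⁅w a, vb b'⁆) := by
      rw [← hL, Finset.sum_comm, Finset.sum_comm (γ := Fin N), Finset.mul_sum]
      refine Finset.sum_congr rfl fun b _ => ?_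
      have := htr (Q.compl₁₂ (πl ∘ₗ (-(LieAlgebra.ad ℝ 𝔤 (vb b)))) (πl ∘ₗ (-(LieAlgebra.ad ℝ 𝔤 (vb b)))))
      simpa only [LinearMap.compl₁₂_apply, LinearMap.comp_apply, LinearMap.neg_apply,
        LieAlgebra.ad_apply, lie_skew] using this
    have e3 : bracketNormSq Q e e e
        = t * ∑ a, ∑ a', h (πn ⁅w a, w a'⁆) (πn ⁅w a, w a'⁆) := by
      simp_rw [hh _ (hπn_mem _) _ (hπn_mem _)]
      have k1 : ∀ x : 𝔤, ∑ b, Q (πn ⁅x, e b⁆) (πn ⁅x, e b⁆)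
          = ∑ a', t * Q (πn ⁅x, w a'⁆) (πn ⁅x, w a'⁆) := by
        intro x
        have := htr (Q.compl₁₂ (πn ∘ₗ (LieAlgebra.ad ℝ 𝔤 x)) (πn ∘ₗ (LieAlgebra.ad ℝ 𝔤 x)))
        rw [Finset.mul_sum] at this
        simpa only [LinearMap.compl₁₂_apply, LinearMap.comp_apply, LieAlgebra.ad_apply] using this
      simp_rw [← k1]
      rw [← hN, Finset.sum_comm, Finset.sum_comm (γ := Fin N), Finset.mul_sum]
      refine Finset.sum_congr rfl fun b _ => ?_
      have := htr (Q.compl₁₂ (πn ∘ₗ (-(LieAlgebra.ad ℝ 𝔤 (e b)))) (πn ∘ₗ (-(LieAlgebra.ad ℝ 𝔤 (e b)))))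
      simpa only [LinearMap.compl₁₂_apply, LinearMap.comp_apply, LinearMap.neg_apply,
        LieAlgebra.ad_apply, lie_skew] using this
    rw [e1, e2, e3]
    field_simp
    ring
  refine ⟨ht, ?_, ⟨n, w0, hw0m, hw0s, hw0o, hw0T⟩, ?_, ?_⟩
  · intro z _ v w
    rw [← mul_add, hQad, mul_zero]
  · intro h hs _ had
    exact huniq h hs had
  · have hSe : S = {-(2 * (∑ a, killingForm ℝ 𝔤 (e a) (e a))
        + bracketNormSq Q e e e + 2 * bracketNormSq Q e vb vb) / (4 * t)} := by
      ext r
      rw [hS, Set.mem_singleton_iff]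
      constructor
      · rintro ⟨h, N, w, hs, _, had, hwm, hws, hwo, hwT, rfl⟩
        have hh := huniq h hs had N w hwm hws hwo hwT
        exact hval h N w hh hwm hws fun a b => by rw [← hh _ (hwm a) _ (hwm b), hwo]
      · rintro rfl
        refine ⟨t • Q, n, w0, ?_, ?_, ?_, hw0m, hw0s, ?_, hw0T, ?_⟩
        · intro v w'
          simp [hQsymm v w']
        · intro v _ hv
          simpa using mul_pos ht (hQpos v hv)
        · intro z _ v _ w' _
          simp only [LinearMap.smul_apply, smul_eq_mul]
          rw [← mul_add, hQad, mul_zero]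
        · intro a b
          simpa using hw0o a b
        · exact (hval (t • Q) n w0 (fun v _ u _ => by simp) hw0m hw0s hw0o).symm
    rw [hSe, csSup_singleton]
end

section
/- Let λ = (2,2,−2), let T₁ < 0 and T₂ = T₃ = 0. Then there exist x₁,x₂,x₃ > 0 and c > 0 such that R_i(λ,x) = c·T_i for i = 1,2,3. Moreover, all such solutions (x,c) have the same value of c, and there exist two solutions (x,c) and (x′,c) such that x′ is not a positive scalar multiple of x. -/
open scoped BigOperators

/-- The diagonal components of the Ricci curvature of the left-invariant metric
`g(V_i,V_j) = δ_{ij} x_i` in a Milnor frame with structure constants `lam`: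
`R_i(λ,x) = x_i (λ_i² x_i² − (λ_j x_j − λ_k x_k)²) / (2 x₁ x₂ x₃)`, where `(i,j,k)`
is the cyclic permutation of `(1,2,3)` starting at `i`. -/
noncomputable def ricMilnor (lam x : Fin 3 → ℝ) (i : Fin 3) : ℝ :=
  x i * ((lam i) ^ 2 * (x i) ^ 2 - (lam (i + 1) * x (i + 1) - lam (i + 2) * x (i + 2)) ^ 2)
    / (2 * x 0 * x 1 * x 2)

theorem aux_sol (T : ℝ) (hT : T < 0) (a b : ℝ) (ha : 0 < a) (hb : 0 < b) :
    (∀ i, 0 < (![a, a + b, b] : Fin 3 → ℝ) i) ∧ 0 < -8 / T ∧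
    (∀ i, ricMilnor ![2, 2, -2] ![a, a + b, b] i = (-8 / T) * ![T, 0, 0] i) := by
  have hT0 : T ≠ 0 := hT.ne
  have hab : 0 < a + b := by positivity
  refine ⟨?_, div_pos_of_neg_of_neg (by norm_num) hT, ?_⟩
  · intro i
    fin_cases i <;> simp [ha, hb, hab]
  · have e1 : (1 : Fin 3) + 1 = 2 := rfl
    have e2 : (1 : Fin 3) + 2 = 0 := rfl
    have e3 : (2 : Fin 3) + 1 = 0 := rfl
    have e4 : (2 : Fin 3) + 2 = 1 := rfl
    have hab' := hab.ne'
    intro i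
    fin_cases i
    · simp [ricMilnor]
      field_simp
      ring
    · simp [ricMilnor, e1, e2]
      refine Or.inl (Or.inr ?_)
      ring
    · simp [ricMilnor, e3, e4]
      refine Or.inl (Or.inr ?_)
      ring

theorem aux_uniq (T : ℝ) (hT : T < 0) (x : Fin 3 → ℝ) (c : ℝ) (hx : ∀ i, 0 < x i)
    (h : ∀ i, ricMilnor ![2, 2, -2] x i = c * ![T, 0, 0] i) : c = -8 / T := by
  have e1 : (1 : Fin 3) + 1 = 2 := rfl
  have e2 : (1 : Fin 3) + 2 = 0 := rfl
  have h0 := h 0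
  have h1 := h 1
  have p0 := hx 0
  have p1 := hx 1
  have p2 := hx 2
  simp only [ricMilnor, e1, e2, zero_add] at h0 h1
  simp at h0 h1
  generalize x 0 = a at *
  generalize x 1 = b at *
  generalize x 2 = d at *
  have hb : b = a + d := by
    have h2 : 2 ^ 2 * b ^ 2 - (-(2 * d) - 2 * a) ^ 2 = 0 := by
      rcases h1 with h1 | h1
      · rcases h1 with h1 | h1
        · exact absurd h1 p1.ne'
        · exact h1
      · rcases h1 with h1 | h1
        · rcases h1 with h1 | h1
          · exact absurd h1 p0.ne'
          · exact absurd h1 p1.ne'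
        · exact absurd h1 p2.ne'
    nlinarith
  subst hb
  have hT0 : T ≠ 0 := hT.ne
  rw [eq_div_iff hT0, ← h0]
  field_simp
  ring

theorem stmt13 (T₁ : ℝ) (hT₁ : T₁ < 0) :
    (∃ (x : Fin 3 → ℝ) (c : ℝ), (∀ i, 0 < x i) ∧ 0 < c ∧ (∀ i, ricMilnor ![2, 2, -2] x i = c * ![T₁, 0, 0] i)) ∧
    (∀ (x x' : Fin 3 → ℝ) (c c' : ℝ),
      (∀ i, 0 < x i) → 0 < c → (∀ i, ricMilnor ![2, 2, -2] x i = c * ![T₁, 0, 0] i) →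
      (∀ i, 0 < x' i) → 0 < c' → (∀ i, ricMilnor ![2, 2, -2] x' i = c' * ![T₁, 0, 0] i) →
      c = c') ∧
    (∃ (x x' : Fin 3 → ℝ) (c : ℝ),
      ((∀ i, 0 < x i) ∧ 0 < c ∧ (∀ i, ricMilnor ![2, 2, -2] x i = c * ![T₁, 0, 0] i)) ∧
      ((∀ i, 0 < x' i) ∧ 0 < c ∧ (∀ i, ricMilnor ![2, 2, -2] x' i = c * ![T₁, 0, 0] i)) ∧
      ¬ (∃ t : ℝ, 0 < t ∧ ∀ i, x' i = t * x i)) := by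
  refine ⟨⟨_, _, aux_sol T₁ hT₁ 1 1 one_pos one_pos⟩, ?_, ?_⟩
  · intro x x' c c' hx _ h hx' _ h'
    rw [aux_uniq T₁ hT₁ x c hx h, aux_uniq T₁ hT₁ x' c' hx' h']
  · refine ⟨_, _, _, aux_sol T₁ hT₁ 1 1 one_pos one_pos, aux_sol T₁ hT₁ 1 2 one_pos two_pos, ?_⟩
    rintro ⟨t, _, h⟩
    have h0 := h 0
    have h2 := h 2
    simp at h0 h2
    linarith
end

section
/- Let λ = (2,−2,0), let T₁ > 0, T₂ < 0, T₃ < 0. Then there exist x₁,x₂,x₃ > 0 and c > 0 such that R_i(λ,x) = c·T_i for i = 1,2,3 if and only if T₁ + T₂ > 0. Moreover, if (x,c) and (x′,c′) are two such solutions, then c = c′ and x′ = t·x for some t > 0. -/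
open scoped BigOperators

theorem ric_iff (T₁ T₂ T₃ : ℝ) (x : Fin 3 → ℝ) (c : ℝ) (h : ∀ i, 0 < x i) :
    (∀ i, ricMilnor ![2, -2, 0] x i = c * ![T₁, T₂, T₃] i) ↔
      (2 * (x 0 ^ 2 - x 1 ^ 2) = c * T₁ * (x 1 * x 2) ∧
       2 * (x 1 ^ 2 - x 0 ^ 2) = c * T₂ * (x 0 * x 2) ∧
       -2 * (x 0 + x 1) ^ 2 = c * T₃ * (x 0 * x 1)) := by
  have h0 := h 0
  have h1 := h 1
  have h2 := h 2
  have e0 : ricMilnor ![2, -2, 0] x 0 = 2 * (x 0 ^ 2 - x 1 ^ 2) / (x 1 * x 2) := by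
    simp [ricMilnor]
    field_simp
  have e1 : ricMilnor ![2, -2, 0] x 1 = 2 * (x 1 ^ 2 - x 0 ^ 2) / (x 0 * x 2) := by
    have a1 : (1 : Fin 3) + 1 = 2 := rfl
    have a2 : (1 : Fin 3) + 2 = 0 := rfl
    simp [ricMilnor, a1, a2]
    field_simp
  have e2 : ricMilnor ![2, -2, 0] x 2 = -2 * (x 0 + x 1) ^ 2 / (x 0 * x 1) := by
    have a1 : (2 : Fin 3) + 1 = 0 := rfl
    have a2 : (2 : Fin 3) + 2 = 1 := rfl
    simp [ricMilnor, a1, a2]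
    field_simp
  rw [Fin.forall_fin_succ, Fin.forall_fin_two]
  change (ricMilnor ![2, -2, 0] x 0 = c * T₁ ∧ ricMilnor ![2, -2, 0] x 1 = c * T₂ ∧
    ricMilnor ![2, -2, 0] x 2 = c * T₃) ↔ _
  rw [e0, e1, e2, div_eq_iff (by positivity), div_eq_iff (by positivity),
    div_eq_iff (by positivity)]

theorem ric_ratio {T₁ T₂ a b z c : ℝ} (hz : 0 < z) (hc : 0 < c)
    (e1 : 2 * (a ^ 2 - b ^ 2) = c * T₁ * (b * z))
    (e2 : 2 * (b ^ 2 - a ^ 2) = c * T₂ * (a * z)) : T₁ * b = -T₂ * a := by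
  have : (c * z) * (T₁ * b + T₂ * a) = 0 := by linarith
  have h := (mul_eq_zero.mp this).resolve_left (by positivity)
  linarith

theorem stmt16 (T₁ T₂ T₃ : ℝ) (hT₁ : 0 < T₁) (hT₂ : T₂ < 0) (hT₃ : T₃ < 0) :
    ((∃ (x : Fin 3 → ℝ) (c : ℝ), (∀ i, 0 < x i) ∧ 0 < c ∧ (∀ i, ricMilnor ![2, -2, 0] x i = c * ![T₁, T₂, T₃] i)) ↔ T₁ + T₂ > 0) ∧
    (∀ (x x' : Fin 3 → ℝ) (c c' : ℝ),
      (∀ i, 0 < x i) → 0 < c → (∀ i, ricMilnor ![2, -2, 0] x i = c * ![T₁, T₂, T₃] i) →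
      (∀ i, 0 < x' i) → 0 < c' → (∀ i, ricMilnor ![2, -2, 0] x' i = c' * ![T₁, T₂, T₃] i) →
      c = c' ∧ (∃ t : ℝ, 0 < t ∧ ∀ i, x' i = t * x i)) := by
  refine ⟨⟨?_, ?_⟩, ?_⟩
  · rintro ⟨x, c, hx, hc, h⟩
    rw [ric_iff T₁ T₂ T₃ x c hx] at h
    obtain ⟨e1, e2, e3⟩ := h
    have h0 := hx 0
    have h1 := hx 1
    have h2 := hx 2
    have hr := ric_ratio h2 hc e1 e2
    have hp : 0 < c * T₁ * (x 1 * x 2) := by positivity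
    have hab : x 1 < x 0 := by nlinarith
    by_contra hn
    nlinarith
  · intro hT
    have hb : 0 < -T₂ := by linarith
    have hd : 0 < -T₃ := by linarith
    have hs : 0 < T₁ - T₂ := by linarith
    have hT' : 0 < T₁ + T₂ := hT
    obtain ⟨c, hcd⟩ : ∃ c, c = 2 * (T₁ - T₂) ^ 2 / (T₁ * (-T₂) * (-T₃)) := ⟨_, rfl⟩
    have hc : 0 < c := by rw [hcd]; positivity
    have hc' : c * (T₁ * (-T₂) * (-T₃)) = 2 * (T₁ - T₂) ^ 2 := by
      rw [hcd]; exact div_mul_cancel₀ _ (by positivity)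
    obtain ⟨z, hzd⟩ : ∃ z, z = 2 * ((T₁ - T₂) * (T₁ + T₂)) / (c * T₁ * (-T₂)) := ⟨_, rfl⟩
    have hz : 0 < z := by rw [hzd]; positivity
    have hz' : z * (c * T₁ * (-T₂)) = 2 * ((T₁ - T₂) * (T₁ + T₂)) := by
      rw [hzd]; exact div_mul_cancel₀ _ (by positivity)
    have hx : ∀ i, 0 < (![T₁, -T₂, z] : Fin 3 → ℝ) i := by
      rw [Fin.forall_fin_succ, Fin.forall_fin_two]
      exact ⟨hT₁, hb, hz⟩
    refine ⟨![T₁, -T₂, z], c, hx, hc, ?_⟩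
    rw [ric_iff T₁ T₂ T₃ _ c hx]
    change 2 * (T₁ ^ 2 - (-T₂) ^ 2) = c * T₁ * (-T₂ * z) ∧
      2 * ((-T₂) ^ 2 - T₁ ^ 2) = c * T₂ * (T₁ * z) ∧
      -2 * (T₁ + -T₂) ^ 2 = c * T₃ * (T₁ * -T₂)
    refine ⟨?_, ?_, ?_⟩ <;> linarith
  · intro x x' c c' hx hc h hx' hc' h'
    rw [ric_iff T₁ T₂ T₃ x c hx] at h
    rw [ric_iff T₁ T₂ T₃ x' c' hx'] at h'
    obtain ⟨e1, e2, e3⟩ := h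
    obtain ⟨f1, f2, f3⟩ := h'
    have h0 := hx 0
    have h1 := hx 1
    have h2 := hx 2
    have k0 := hx' 0
    have k1 := hx' 1
    have k2 := hx' 2
    have hr := ric_ratio h2 hc e1 e2
    have kr := ric_ratio k2 hc' f1 f2
    obtain ⟨t, htd⟩ : ∃ t, t = x' 0 / x 0 := ⟨_, rfl⟩
    have ht : 0 < t := by rw [htd]; positivity
    have t0 : x' 0 = t * x 0 := by rw [htd]; field_simp
    have t1 : x' 1 = t * x 1 := by
      apply mul_left_cancel₀ hT₁.ne'
      rw [kr, t0]
      linear_combination (-t) * hr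
    have hcc : c = c' := by
      rw [t0, t1] at f3
      have : (t ^ 2 * (x 0 * x 1) * T₃) * (c - c') = 0 := by
        linear_combination (-t ^ 2) * e3 + f3
      have h := (mul_eq_zero.mp this).resolve_left
        (mul_ne_zero (by positivity) hT₃.ne)
      linarith
    subst hcc
    refine ⟨rfl, t, ht, ?_⟩
    have t2 : x' 2 = t * x 2 := by
      rw [t0, t1] at f1
      have : (c * T₁ * t * x 1) * (x' 2 - t * x 2) = 0 := by
        linear_combination t ^ 2 * e1 - f1
      have h := (mul_eq_zero.mp this).resolve_left (by positivity)
      linarith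
    rw [Fin.forall_fin_succ, Fin.forall_fin_two]
    exact ⟨t0, t1, t2⟩
end
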